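/- As β → ∞, the random vector √β·(λ_1(A_β) − h_1^{(k)}/√(2k), λ_2(A_β) − h_2^{(k)}/√(2k), …, λ_k(A_β) − h_k^{(k)}/√(2k)) converges in distribution to (1/√(2k))·G, where G = (G_1,…,G_k) is a centered k-variate Gaussian vector with covariance Cov(G_i, G_j) = [ Σ_{l=0}^{k−1} H_l²(h_i^{(k)})·H_l²(h_j^{(k)}) + Σ_{l=0}^{k−2} H_{l+1}(h_i^{(k)})·H_l(h_i^{(k)})·H_{l+1}(h_j^{(k)})·H_l(h_j^{(k)}) ] / [ (Σ_{l=0}^{k−1} H_l²(h_i^{(k)})) · (Σ_{l=0}^{k−1} H_l²(h_j^{(k)})) ]. -/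

import Mathlib

open MeasureTheory ProbabilityTheory Filter Polynomial Matrix Topology Asymptotics

instance matrixMeasurableSpace {m n α : Type*} [MeasurableSpace α] :
    MeasurableSpace (Matrix m n α) := MeasurableSpace.pi

noncomputable section

/-- The chi distribution with parameter `r`: the measure on `ℝ` with density
`2^(1-r/2) x^(r-1) e^(-x²/2) / Γ(r/2)` on `(0,∞)`. -/
def chiMeasure (r : ℝ) : Measure ℝ :=
  volume.withDensity fun x => ENNReal.ofReal
    (Set.indicator (Set.Ioi (0:ℝ))
      (fun x => (2:ℝ) ^ (1 - r / 2) * x ^ (r - 1) * Real.exp (-x ^ 2 / 2) / Real.Gamma (r / 2)) x)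

/-- The `i`-th largest root of the characteristic polynomial (counted with multiplicity);
for a real symmetric matrix this is its `i`-th largest eigenvalue. -/
def ithLargestEig {n : ℕ} (M : Matrix (Fin n) (Fin n) ℝ) (i : Fin n) : ℝ :=
  (M.charpoly.roots.sort (· ≤ ·)).getD (n - 1 - (i : ℕ)) 0

def finL {k : ℕ} (l : Fin (k - 1)) : Fin k := ⟨l, by have := l.isLt; omega⟩
def finR {k : ℕ} (l : Fin (k - 1)) : Fin k := ⟨(l : ℕ) + 1, by have := l.isLt; omega⟩

/-- Symmetric tridiagonal matrix with diagonal `d` and off-diagonal `e`. -/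
def symTridiagOf {k : ℕ} (d : Fin k → ℝ) (e : Fin (k - 1) → ℝ) : Matrix (Fin k) (Fin k) ℝ :=
  Matrix.of fun i j =>
    if i = j then d i
    else if h : (i : ℕ) + 1 = (j : ℕ) then e ⟨i, by have := j.isLt; omega⟩
    else if h' : (j : ℕ) + 1 = (i : ℕ) then e ⟨j, by have := i.isLt; omega⟩
    else 0

/-- Lower bidiagonal matrix with diagonal `d` and subdiagonal `e`. -/
def lowerBidiagOf {k : ℕ} (d : Fin k → ℝ) (e : Fin (k - 1) → ℝ) : Matrix (Fin k) (Fin k) ℝ :=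
  Matrix.of fun i j =>
    if i = j then d i
    else if h : (j : ℕ) + 1 = (i : ℕ) then e ⟨j, by have := i.isLt; omega⟩
    else 0

/-- The Hermite polynomials, orthonormal with respect to the weight `e^(-x²)` on `ℝ`,
with positive leading coefficients; they satisfy
`x·H n x = √((n+1)/2)·H (n+1) x + √(n/2)·H (n-1) x`. -/
def Hpoly : ℕ → ℝ → ℝ
  | 0 => fun _ => Real.pi ^ (-(1:ℝ)/4)
  | 1 => fun x => Real.sqrt 2 * x * Real.pi ^ (-(1:ℝ)/4)
  | (n+2) => fun x =>
      (x * Hpoly (n+1) x - Real.sqrt (((n:ℝ)+1)/2) * Hpoly n x) / Real.sqrt (((n:ℝ)+2)/2)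

/-- The monic (probabilists') Hermite polynomials:
`He 0 = 1`, `He 1 = X`, `He (n+1) = X·He n - n·He (n-1)`. -/
def heP : ℕ → Polynomial ℝ
  | 0 => 1
  | 1 => Polynomial.X
  | (n+2) => Polynomial.X * heP (n+1) - Polynomial.C ((n:ℝ)+1) * heP n

/-- The generalized Laguerre polynomials of parameter `γ`, orthonormal with respect to the
weight `x^γ e^(-x)` on `[0,∞)` (formally defined for all real `γ`), with positive leading
coefficients; they satisfy
`x·L n x = √((n+1)(n+γ+1))·L (n+1) x + (2n+γ+1)·L n x + √(n(n+γ))·L (n-1) x`. -/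
def Lag (γ : ℝ) : ℕ → ℝ → ℝ
  | 0 => fun _ => Real.Gamma (γ+1) ^ (-(1:ℝ)/2)
  | 1 => fun x => (x - (γ+1)) * Real.Gamma (γ+1) ^ (-(1:ℝ)/2) / Real.sqrt (γ+1)
  | (n+2) => fun x =>
      ((x - (2*((n:ℝ)+1)+γ+1)) * Lag γ (n+1) x
        - Real.sqrt (((n:ℝ)+1)*(((n:ℝ)+1)+γ)) * Lag γ n x)
      / Real.sqrt (((n:ℝ)+2)*(((n:ℝ)+2)+γ))

/-- The fixed `k×k` symmetric tridiagonal matrix `H` with zero diagonal and off-diagonal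
entries `√(k-j)/√2`, `j = 1,…,k-1`. -/
def hermiteH (k : ℕ) : Matrix (Fin k) (Fin k) ℝ :=
  symTridiagOf (fun _ => 0) (fun j => Real.sqrt ((k:ℝ) - 1 - (j:ℕ)) / Real.sqrt 2)

/-- The fixed `k×k` lower bidiagonal matrix `B_γ` with diagonal `√(γ+k-j)` and
subdiagonal `√(k-j)`. -/
def lagB (k : ℕ) (γ : ℝ) : Matrix (Fin k) (Fin k) ℝ :=
  lowerBidiagOf (fun j => Real.sqrt (γ + (k:ℝ) - 1 - (j:ℕ)))
    (fun j => Real.sqrt ((k:ℝ) - 1 - (j:ℕ)))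

/-- The fixed tridiagonal Laguerre matrix `L_γ = B_γ B_γᵀ`. -/
def lagL (k : ℕ) (γ : ℝ) : Matrix (Fin k) (Fin k) ℝ := lagB k γ * (lagB k γ)ᵀ

/-- Law of the β-Hermite tridiagonal matrix model of size `k`, scaled by `1/√(2kβ)`:
independent `N(0,1)` diagonal entries and `(1/√2)·χ_((k-j)β)` off-diagonal entries. -/
def hermiteLaw (k : ℕ) (β : ℝ) : Measure (Matrix (Fin k) (Fin k) ℝ) :=
  Measure.map (fun p : (Fin k → ℝ) × (Fin (k-1) → ℝ) =>
      (Real.sqrt (2 * (k:ℝ) * β))⁻¹ • symTridiagOf p.1 p.2)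
    ((Measure.pi fun _ : Fin k => gaussianReal 0 1).prod
      (Measure.pi fun j : Fin (k-1) =>
        Measure.map (fun x => x / Real.sqrt 2) (chiMeasure (((k:ℝ) - 1 - (j:ℕ)) * β))))

/-- Law of the limiting symmetric tridiagonal Gaussian matrix `Z` (Hermite case):
i.i.d. `N(0,1)` diagonal entries and i.i.d. `N(0,1/4)` off-diagonal entries. -/
def zLaw (k : ℕ) : Measure (Matrix (Fin k) (Fin k) ℝ) :=
  Measure.map (fun p : (Fin k → ℝ) × (Fin (k-1) → ℝ) => symTridiagOf p.1 p.2)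
    ((Measure.pi fun _ : Fin k => gaussianReal 0 1).prod
      (Measure.pi fun _ : Fin (k-1) => gaussianReal 0 (1/4)))

/-- Law of the β-Laguerre matrix model of size `k` with parameter `a`, scaled by `1/(kβ)`:
`B = (1/(kβ)) X Xᵀ` with `X` lower bidiagonal, `X_jj ~ χ_(2a-β(j-1))`, `X_(j+1,j) ~ χ_(β(k-j))`. -/
def lagLaw (k : ℕ) (β a : ℝ) : Measure (Matrix (Fin k) (Fin k) ℝ) :=
  Measure.map (fun p : (Fin k → ℝ) × (Fin (k-1) → ℝ) =>
      (((k:ℝ) * β)⁻¹) • (lowerBidiagOf p.1 p.2 * (lowerBidiagOf p.1 p.2)ᵀ))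
    ((Measure.pi fun j : Fin k => chiMeasure (2 * a - β * (j:ℕ))).prod
      (Measure.pi fun j : Fin (k-1) => chiMeasure (β * ((k:ℝ) - 1 - (j:ℕ)))))

/-- Law of the limiting lower bidiagonal Gaussian matrix `Z` (Laguerre case):
i.i.d. `N(0,1)` diagonal and subdiagonal entries. -/
def zBidLaw (k : ℕ) : Measure (Matrix (Fin k) (Fin k) ℝ) :=
  Measure.map (fun p : (Fin k → ℝ) × (Fin (k-1) → ℝ) => lowerBidiagOf p.1 p.2)
    ((Measure.pi fun _ : Fin k => gaussianReal 0 1).prod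
      (Measure.pi fun _ : Fin (k-1) => gaussianReal 0 1))

/-- `ν` is the centered `k`-variate Gaussian distribution with covariance matrix `S`:
every linear functional has the corresponding one-dimensional centered Gaussian law. -/
def IsCenteredGaussianVec {k : ℕ} (ν : Measure (Fin k → ℝ)) (S : Fin k → Fin k → ℝ) : Prop :=
  IsProbabilityMeasure ν ∧ ∀ c : Fin k → ℝ,
    Measure.map (fun x => ∑ i, c i * x i) ν =
      gaussianReal 0 (∑ i, ∑ j, c i * c j * S i j).toNNReal

/-- Covariance of the limiting Gaussian fluctuation vector in the β-Hermite case. -/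
def hermCov (k : ℕ) (h : Fin k → ℝ) (i j : Fin k) : ℝ :=
  ((∑ l ∈ Finset.range k, (Hpoly l (h i))^2 * (Hpoly l (h j))^2) +
    ∑ l ∈ Finset.range (k-1),
      Hpoly (l+1) (h i) * Hpoly l (h i) * Hpoly (l+1) (h j) * Hpoly l (h j)) /
  ((∑ l ∈ Finset.range k, (Hpoly l (h i))^2) * (∑ l ∈ Finset.range k, (Hpoly l (h j))^2))

theorem antitone_eq_of_map_univ_eq {n : ℕ} {f g : Fin n → ℝ} (hf : Antitone f) (hg : Antitone g)
    (h : Multiset.map f Finset.univ.val = Multiset.map g Finset.univ.val) : f = g := by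
  simp only [Fin.univ_val_map, Multiset.coe_eq_coe] at h
  exact List.ofFn_injective
    (h.eq_of_pairwise (fun a b _ _ h₁ h₂ => le_antisymm h₂ h₁)
      (List.sortedGE_iff_pairwise.1 hf.sortedGE_ofFn)
      (List.sortedGE_iff_pairwise.1 hg.sortedGE_ofFn))

theorem ithLargestEig_eq_getElem {n : ℕ} {M : Matrix (Fin n) (Fin n) ℝ}
    (hM : M.charpoly.roots.card = n) (i : Fin n) :
    ithLargestEig M i = (M.charpoly.roots.sort (· ≤ ·)).get
      ((Fin.rev i).cast (by simp [hM])) := by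
  have hlt : n - 1 - (i : ℕ) < (M.charpoly.roots.sort (· ≤ ·)).length := by
    have := i.isLt
    simp only [Multiset.length_sort, hM]
    omega
  rw [ithLargestEig, List.getD_eq_getElem _ _ hlt]
  simp only [List.get_eq_getElem, Fin.val_cast, Fin.val_rev]
  congr 1
  omega

theorem ithLargestEig_antitone {n : ℕ} {M : Matrix (Fin n) (Fin n) ℝ}
    (hM : M.charpoly.roots.card = n) : Antitone (ithLargestEig M) := by
  intro i j hij
  rw [ithLargestEig_eq_getElem hM, ithLargestEig_eq_getElem hM]
  exact (M.charpoly.roots.pairwise_sort (· ≤ ·)).rel_get_of_le (by simpa using hij)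

theorem map_ithLargestEig {n : ℕ} {M : Matrix (Fin n) (Fin n) ℝ}
    (hM : M.charpoly.roots.card = n) :
    Multiset.map (ithLargestEig M) Finset.univ.val = M.charpoly.roots := by
  have hlen : (M.charpoly.roots.sort (· ≤ ·)).length = n := by simp [hM]
  have h₁ : ithLargestEig M =
      (M.charpoly.roots.sort (· ≤ ·)).get ∘ (finCongr hlen.symm) ∘ Fin.revPerm := by
    ext i
    rw [ithLargestEig_eq_getElem hM]
    rfl
  have h₂ : Multiset.map (fun i => ((finCongr hlen.symm) ∘ Fin.revPerm) i)
      (Finset.univ : Finset (Fin n)).val = Finset.univ.val :=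
    Multiset.map_univ_val_equiv (Fin.revPerm.trans (finCongr hlen.symm))
  rw [h₁, ← Multiset.map_map, h₂]
  conv_rhs => rw [← Multiset.sort_eq M.charpoly.roots (· ≤ ·)]
  rw [Fin.univ_val_map, List.ofFn_get]

theorem ithLargestEig_eq_of_strictAnti {n : ℕ} {M : Matrix (Fin n) (Fin n) ℝ} {g : Fin n → ℝ}
    (hg : StrictAnti g) (hroot : ∀ i, M.charpoly.IsRoot (g i)) : ithLargestEig M = g := by
  have hmap : Multiset.map g Finset.univ.val = M.charpoly.roots := by
    refine Multiset.eq_of_le_of_card_le ?_ ?_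
    · rw [Multiset.le_iff_subset (Finset.univ.nodup.map hg.injective)]
      intro x hx
      obtain ⟨i, -, rfl⟩ := Multiset.mem_map.1 hx
      exact (Polynomial.mem_roots M.charpoly_monic.ne_zero).2 (hroot i)
    · simpa using M.charpoly.card_roots'
  have hM : M.charpoly.roots.card = n := by rw [← hmap]; simp
  exact antitone_eq_of_map_univ_eq (ithLargestEig_antitone hM) hg.antitone
    ((map_ithLargestEig hM).trans hmap.symm)

theorem card_roots_charpoly_of_isHermitian {n : ℕ} {M : Matrix (Fin n) (Fin n) ℝ}
    (hM : M.IsHermitian) : M.charpoly.roots.card = n := by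
  simp [hM.roots_charpoly_eq_eigenvalues]

/-- The values at the naturals of the monic polynomial with roots `x` determine the antitone
vector `x`, measurably. -/
theorem measurableEmbedding_prod_natCast_sub (n : ℕ) :
    MeasurableEmbedding ({x : Fin n → ℝ | Antitone x}.domRestrict
      fun x (m : ℕ) => ∏ i, ((m : ℝ) - x i)) := by
  have hclosed : IsClosed {x : Fin n → ℝ | Antitone x} := by
    simp only [Antitone, Set.ofPred_forall]
    exact isClosed_iInter fun i => isClosed_iInter fun j => isClosed_iInter fun _ =>
      isClosed_le (continuous_apply j) (continuous_apply i)
  refine ContinuousOn.measurableEmbedding hclosed.measurableSet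
    (by fun_prop : Continuous _).continuousOn ?_
  intro x hx y hy hxy
  have hpoly : (∏ i, (X - C (x i))) = ∏ i, (X - C (y i)) := by
    refine Polynomial.eq_of_infinite_eval_eq _ _
      ((Set.infinite_range_of_injective (Nat.cast_injective (R := ℝ))).mono ?_)
    rintro _ ⟨m, rfl⟩
    simpa [Polynomial.eval_prod] using congrFun hxy m
  refine antitone_eq_of_map_univ_eq hx hy ?_
  have := congrArg Polynomial.roots hpoly
  simpa [Polynomial.roots_prod, Finset.prod_ne_zero_iff, Polynomial.X_sub_C_ne_zero] using this

theorem measurable_ithLargestEig {Ω : Type*} [MeasurableSpace Ω] {n : ℕ}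
    {M : Ω → Matrix (Fin n) (Fin n) ℝ} (hM : Measurable M) (hsymm : ∀ ω, (M ω).IsHermitian) :
    Measurable fun ω => ithLargestEig (M ω) := by
  let E : Ω → {x : Fin n → ℝ | Antitone x} := fun ω =>
    ⟨ithLargestEig (M ω), ithLargestEig_antitone (card_roots_charpoly_of_isHermitian (hsymm ω))⟩
  suffices Measurable E from measurable_subtype_coe.comp this
  rw [← (measurableEmbedding_prod_natCast_sub n).measurable_comp_iff, measurable_pi_iff]
  intro m
  have hdet : ∀ ω, ∏ i, ((m : ℝ) - ithLargestEig (M ω) i) =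
      (Matrix.scalar (Fin n) (m : ℝ) - M ω).det := by
    intro ω
    have hcard := card_roots_charpoly_of_isHermitian (hsymm ω)
    rw [← Matrix.eval_charpoly, (hsymm ω).splits_charpoly.eq_prod_roots_of_monic
      (M ω).charpoly_monic, ← map_ithLargestEig hcard, Multiset.map_map]
    change _ = eval (m : ℝ) (∏ i, (X - C (ithLargestEig (M ω) i)))
    simp [Polynomial.eval_prod]
  change Measurable fun ω => ∏ i, ((m : ℝ) - ithLargestEig (M ω) i)
  simp_rw [hdet, Matrix.det_apply]
  refine Finset.measurable_sum _ fun σ _ => Measurable.const_smul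
    (Finset.measurable_prod _ fun i _ => ?_) _
  exact measurable_const.sub ((measurable_pi_apply i).comp ((measurable_pi_apply (σ i)).comp hM))

theorem Matrix.IsHermitian.exists_isRoot_charpoly_near {n : ℕ} {A : Matrix (Fin n) (Fin n) ℝ}
    (hA : A.IsHermitian) {v : Fin n → ℝ} (hv : 0 < v ⬝ᵥ v) {μ δ : ℝ} (hδ : 0 ≤ δ)
    (h : (A *ᵥ v - μ • v) ⬝ᵥ (A *ᵥ v - μ • v) ≤ δ ^ 2 * (v ⬝ᵥ v)) :
    ∃ x, A.charpoly.IsRoot x ∧ |x - μ| ≤ δ := by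
  set b := hA.eigenvectorBasis
  have parseval : ∀ y : Fin n → ℝ, y ⬝ᵥ y = ∑ j, ((b j).ofLp ⬝ᵥ y) ^ 2 := by
    intro y
    have := b.sum_sq_norm_inner_right (WithLp.toLp 2 y)
    simp only [EuclideanSpace.norm_sq_eq, EuclideanSpace.inner_eq_star_dotProduct,
      Real.norm_eq_abs, sq_abs] at this
    simp only [dotProduct, ← sq]
    simp only [star_trivial, dotProduct] at this
    rw [← this]
    exact Finset.sum_congr rfl fun j _ => by
      congr 1
      exact Finset.sum_congr rfl fun _ _ => mul_comm _ _
  have coeff : ∀ j, (b j).ofLp ⬝ᵥ (A *ᵥ v - μ • v) =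
      (hA.eigenvalues j - μ) * ((b j).ofLp ⬝ᵥ v) := by
    intro j
    have h₁ : (b j).ofLp ⬝ᵥ (A *ᵥ v) = (A *ᵥ (b j).ofLp) ⬝ᵥ v := by
      rw [Matrix.dotProduct_mulVec, ← Matrix.mulVec_transpose]
      congr 2
    rw [dotProduct_sub, h₁, hA.mulVec_eigenvectorBasis, smul_dotProduct, dotProduct_smul]
    simp only [smul_eq_mul]
    ring
  by_contra! hcon
  have hfar : ∀ j, δ ^ 2 < (hA.eigenvalues j - μ) ^ 2 := by
    intro j
    have hroot : A.charpoly.IsRoot (hA.eigenvalues j) := by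
      refine Polynomial.isRoot_of_mem_roots ?_
      rw [hA.roots_charpoly_eq_eigenvalues]
      exact Multiset.mem_map_of_mem _ (Finset.mem_univ_val j)
    rw [← sq_abs (hA.eigenvalues j - μ)]
    exact pow_lt_pow_left₀ (hcon _ hroot) hδ two_ne_zero
  refine absurd h (not_le.2 ?_)
  rw [parseval (A *ᵥ v - μ • v)]
  rw [parseval v] at hv ⊢
  rw [Finset.mul_sum]
  obtain ⟨j, -, hj⟩ := Finset.exists_ne_zero_of_sum_ne_zero hv.ne'
  refine Finset.sum_lt_sum (fun j _ => ?_) ⟨j, Finset.mem_univ j, ?_⟩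
  · rw [coeff, mul_pow]
    exact mul_le_mul_of_nonneg_right (hfar j).le (sq_nonneg _)
  · rw [coeff, mul_pow]
    exact mul_lt_mul_of_pos_right (hfar j) (lt_of_le_of_ne (sq_nonneg _) hj.symm)

theorem sum_dotProduct_div_smul_eq {n : ℕ} {v : Fin n → Fin n → ℝ} (hv : ∀ i, v i ⬝ᵥ v i ≠ 0)
    (horth : ∀ i j, i ≠ j → v i ⬝ᵥ v j = 0) (u : Fin n → ℝ) :
    ∑ j, (v j ⬝ᵥ u / (v j ⬝ᵥ v j)) • v j = u := by
  have hgram : Matrix.of v * (Matrix.of v)ᵀ = Matrix.diagonal fun i => v i ⬝ᵥ v i := by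
    ext i j
    rw [Matrix.diagonal_apply]
    split_ifs with hij
    · subst hij; rfl
    · exact horth i j hij
  have hdet : (Matrix.of v).det ≠ 0 := by
    intro h0
    have := congrArg Matrix.det hgram
    rw [Matrix.det_mul, h0, zero_mul, Matrix.det_diagonal] at this
    exact Finset.prod_ne_zero_iff.2 (fun i _ => hv i) this.symm
  refine sub_eq_zero.1 (Matrix.eq_zero_of_mulVec_eq_zero hdet ?_)
  ext i
  change v i ⬝ᵥ _ = 0
  rw [dotProduct_sub, dotProduct_sum, Finset.sum_eq_single i]
  · rw [dotProduct_smul, smul_eq_mul, div_mul_cancel₀ _ (hv i), sub_self]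
  · intro j _ hj
    rw [dotProduct_smul, horth i j hj.symm, smul_zero]
  · simp

/-- First order correction of an eigenvector under a perturbation `Z`. -/
theorem exists_eigenvector_correction {n : ℕ} {H : Matrix (Fin n) (Fin n) ℝ} {h : Fin n → ℝ}
    {v : Fin n → Fin n → ℝ} (hinj : Function.Injective h) (hv : ∀ i, v i ⬝ᵥ v i ≠ 0)
    (horth : ∀ i j, i ≠ j → v i ⬝ᵥ v j = 0) (hev : ∀ i, H *ᵥ v i = h i • v i)
    (Z : Matrix (Fin n) (Fin n) ℝ) (i : Fin n) :
    ∃ w, v i ⬝ᵥ w = 0 ∧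
      H *ᵥ w - h i • w = (v i ⬝ᵥ (Z *ᵥ v i) / (v i ⬝ᵥ v i)) • v i - Z *ᵥ v i := by
  refine ⟨∑ j ∈ Finset.univ.erase i,
    ((v j ⬝ᵥ (Z *ᵥ v i) / (v j ⬝ᵥ v j)) / (h i - h j)) • v j, ?_, ?_⟩
  · rw [dotProduct_sum]
    refine Finset.sum_eq_zero fun j hj => ?_
    rw [dotProduct_smul, horth i j (Finset.ne_of_mem_erase hj).symm, smul_zero]
  · have hsum := sum_dotProduct_div_smul_eq hv horth (Z *ᵥ v i)
    rw [← Finset.add_sum_erase _ _ (Finset.mem_univ i)] at hsum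
    rw [eq_sub_of_add_eq hsum, sub_sub_cancel_left, Matrix.mulVec_sum, Finset.smul_sum,
      ← Finset.sum_sub_distrib, ← Finset.sum_neg_distrib]
    refine Finset.sum_congr rfl fun j hj => ?_
    have hne : h i - h j ≠ 0 := sub_ne_zero.2 fun he => Finset.ne_of_mem_erase hj (hinj he).symm
    rw [Matrix.mulVec_smul, hev, smul_smul, smul_smul, ← sub_smul, ← neg_smul]
    congr 1
    generalize v j ⬝ᵥ (Z *ᵥ v i) / (v j ⬝ᵥ v j) = a
    field_simp
    ring

theorem isRoot_charpoly_smul {n : ℕ} {M : Matrix (Fin n) (Fin n) ℝ} {x : ℝ} (κ : ℝ)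
    (hx : M.charpoly.IsRoot x) : (κ • M).charpoly.IsRoot (κ * x) := by
  rw [Polynomial.IsRoot, Matrix.eval_charpoly] at hx ⊢
  have : Matrix.scalar (Fin n) (κ * x) - κ • M = κ • (Matrix.scalar (Fin n) x - M) := by
    rw [smul_sub]
    congr 1
    ext i j
    simp [Matrix.diagonal_apply]
  rw [this, Matrix.det_smul, hx, mul_zero]

/-- First order perturbation of the ordered eigenvalues of a symmetric matrix with simple
spectrum. -/
theorem tendsto_ithLargestEig_perturbation {n : ℕ} {H Z : Matrix (Fin n) (Fin n) ℝ}
    (hH : H.IsHermitian) (hZ : Z.IsHermitian) {h : Fin n → ℝ} (hanti : StrictAnti h)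
    {v : Fin n → Fin n → ℝ} (hv : ∀ i, v i ⬝ᵥ v i ≠ 0) (hev : ∀ i, H *ᵥ v i = h i • v i)
    {κ : ℝ} (hκ : 0 < κ) (i : Fin n) :
    Tendsto (fun t : ℝ => t⁻¹ * (ithLargestEig (κ • (H + t • Z)) i - κ * h i)) (𝓝[>] 0)
      (𝓝 (κ * (v i ⬝ᵥ (Z *ᵥ v i) / (v i ⬝ᵥ v i)))) := by
  have horth : ∀ i j, i ≠ j → v i ⬝ᵥ v j = 0 := by
    intro i j hij
    have h₁ : v i ⬝ᵥ (H *ᵥ v j) = (H *ᵥ v i) ⬝ᵥ v j := by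
      rw [Matrix.dotProduct_mulVec, ← Matrix.mulVec_transpose]
      congr 2
    rw [hev, hev, dotProduct_smul, smul_dotProduct, smul_eq_mul, smul_eq_mul] at h₁
    have h₂ : (h j - h i) * (v i ⬝ᵥ v j) = 0 := by linarith
    exact (mul_eq_zero.1 h₂).resolve_left (sub_ne_zero.2 fun he => hij (hanti.injective he).symm)
  set c : Fin n → ℝ := fun i => v i ⬝ᵥ (Z *ᵥ v i) / (v i ⬝ᵥ v i) with hc
  choose w hw₀ hw using
    exists_eigenvector_correction hanti.injective hv horth hev Z
  have hvpos : ∀ i, 0 < v i ⬝ᵥ v i := fun i =>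
    lt_of_le_of_ne (Finset.sum_nonneg fun _ _ => mul_self_nonneg _) (hv i).symm
  set r : Fin n → Fin n → ℝ := fun i => Z *ᵥ w i - c i • w i with hr
  set K : Fin n → ℝ := fun i => √(r i ⬝ᵥ r i / (v i ⬝ᵥ v i)) with hK
  have hnear : ∀ t : ℝ, ∀ i, ∃ x, (H + t • Z).charpoly.IsRoot x ∧
      |x - (h i + t * c i)| ≤ K i * t ^ 2 := by
    intro t i
    have hself : ∀ y : Fin n → ℝ, 0 ≤ y ⬝ᵥ y := fun y =>
      Finset.sum_nonneg fun _ _ => mul_self_nonneg _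
    have hnorm : (v i + t • w i) ⬝ᵥ (v i + t • w i) = v i ⬝ᵥ v i + t ^ 2 * (w i ⬝ᵥ w i) := by
      have := hw₀ i
      simp only [add_dotProduct, dotProduct_add, smul_dotProduct, dotProduct_smul,
        dotProduct_comm (w i) (v i), this, smul_eq_mul]
      ring
    have hle : v i ⬝ᵥ v i ≤ (v i + t • w i) ⬝ᵥ (v i + t • w i) := by
      rw [hnorm]
      exact le_add_of_nonneg_right (mul_nonneg (sq_nonneg t) (hself _))
    have hres : (H + t • Z) *ᵥ (v i + t • w i) - (h i + t * c i) • (v i + t • w i) =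
        t ^ 2 • r i := by
      have hHw : H *ᵥ w i = h i • w i + (c i • v i - Z *ᵥ v i) := by
        rw [← hw i]; abel
      simp only [hr, Matrix.add_mulVec, Matrix.mulVec_add, Matrix.smul_mulVec,
        Matrix.mulVec_smul, hev, hHw]
      module
    refine (hH.add (hZ.smul (IsSelfAdjoint.all t))).exists_isRoot_charpoly_near
      ((hvpos i).trans_le hle) (mul_nonneg (Real.sqrt_nonneg _) (sq_nonneg t)) ?_
    rw [hres, mul_pow, hK, Real.sq_sqrt (div_nonneg (hself _) (hself _))]
    calc (t ^ 2 • r i) ⬝ᵥ (t ^ 2 • r i)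
        = r i ⬝ᵥ r i / (v i ⬝ᵥ v i) * (t ^ 2) ^ 2 * (v i ⬝ᵥ v i) := by
          rw [smul_dotProduct, dotProduct_smul, smul_eq_mul, smul_eq_mul]
          field_simp [hv i]
      _ ≤ _ := mul_le_mul_of_nonneg_left hle
          (mul_nonneg (div_nonneg (hself _) (hself _)) (sq_nonneg _))
  choose x hx hxnear using hnear
  have hsep : ∀ᶠ t in 𝓝[>] (0 : ℝ), ∀ i j, i < j →
      h j + t * c j + K j * t ^ 2 < h i + t * c i - K i * t ^ 2 := by
    refine eventually_all.2 fun i => eventually_all.2 fun j => ?_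
    by_cases hij : i < j
    · have h₁ : Tendsto (fun t : ℝ => h j + t * c j + K j * t ^ 2) (𝓝[>] 0) (𝓝 (h j)) := by
        refine (Continuous.tendsto' (by fun_prop) 0 _ (by simp)).mono_left nhdsWithin_le_nhds
      have h₂ : Tendsto (fun t : ℝ => h i + t * c i - K i * t ^ 2) (𝓝[>] 0) (𝓝 (h i)) := by
        refine (Continuous.tendsto' (by fun_prop) 0 _ (by simp)).mono_left nhdsWithin_le_nhds
      filter_upwards [h₁.eventually_lt h₂ (hanti hij)] with t ht _ using ht
    · exact Eventually.of_forall fun t hij' => absurd hij' hij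
  have hmain : ∀ᶠ t in 𝓝[>] (0 : ℝ),
      t⁻¹ * (ithLargestEig (κ • (H + t • Z)) i - κ * h i) = κ * (t⁻¹ * (x t i - h i)) := by
    filter_upwards [hsep] with t ht
    have hxanti : StrictAnti fun i => κ * x t i := by
      intro i j hij
      have h₁ := abs_le.1 (hxnear t i)
      have h₂ := abs_le.1 (hxnear t j)
      have := ht i j hij
      exact mul_lt_mul_of_pos_left (by linarith [h₁.1, h₂.2]) hκ
    rw [ithLargestEig_eq_of_strictAnti hxanti fun i => isRoot_charpoly_smul κ (hx t i)]
    ring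
  refine Tendsto.congr' (hmain.mono fun _ h => h.symm) (Tendsto.const_mul κ ?_)
  rw [tendsto_iff_norm_sub_tendsto_zero]
  have hzero : Tendsto (fun t : ℝ => K i * t) (𝓝[>] 0) (𝓝 0) :=
    (Continuous.tendsto' (by fun_prop) 0 _ (by simp)).mono_left nhdsWithin_le_nhds
  refine squeeze_zero' (Eventually.of_forall fun _ => norm_nonneg _) ?_ hzero
  filter_upwards [self_mem_nhdsWithin] with t (ht : 0 < t)
  have : t⁻¹ * (x t i - h i) - c i = t⁻¹ * (x t i - (h i + t * c i)) := by
    field_simp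
    ring
  rw [Real.norm_eq_abs, this, abs_mul, abs_of_pos (inv_pos.2 ht), inv_mul_le_iff₀ ht]
  linarith [hxnear t i]

theorem symTridiagOf_apply_eq_sum {k : ℕ} (d : Fin k → ℝ) (e : Fin (k - 1) → ℝ) (a b : Fin k) :
    symTridiagOf d e a b = (if a = b then d a else 0) +
      ∑ l, e l * ((if a = finL l ∧ b = finR l then 1 else 0) +
        (if a = finR l ∧ b = finL l then 1 else 0)) := by
  simp only [symTridiagOf, Matrix.of_apply, Fin.ext_iff, finL, finR]
  have ha := a.isLt
  have hb := b.isLt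
  split_ifs with h₁ h₂ h₃
  · rw [Finset.sum_eq_zero, add_zero]
    intro l _
    rw [if_neg (by omega), if_neg (by omega), add_zero, mul_zero]
  · rw [Finset.sum_eq_single ⟨a, by omega⟩, if_pos (by simp [h₂]), if_neg (by simp)]
    · simp
    · intro l _ hl
      rw [Ne, Fin.ext_iff] at hl
      simp only at hl
      rw [if_neg (by omega), if_neg (by omega), add_zero, mul_zero]
    · simp
  · rw [Finset.sum_eq_single ⟨b, by omega⟩, if_neg (by simp), if_pos (by simp [h₃])]
    · simp
    · intro l _ hl
      rw [Ne, Fin.ext_iff] at hl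
      simp only at hl
      rw [if_neg (by omega), if_neg (by omega), add_zero, mul_zero]
    · simp
  · rw [Finset.sum_eq_zero, add_zero]
    intro l _
    rw [if_neg (by omega), if_neg (by omega), add_zero, mul_zero]

theorem symTridiagOf_isHermitian {k : ℕ} (d : Fin k → ℝ) (e : Fin (k - 1) → ℝ) :
    (symTridiagOf d e).IsHermitian := by
  ext a b
  rw [Matrix.conjTranspose_apply, star_trivial, symTridiagOf_apply_eq_sum,
    symTridiagOf_apply_eq_sum]
  congr 1
  · by_cases h : a = b <;> simp [h, eq_comm]
  · refine Finset.sum_congr rfl fun l _ => ?_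
    rw [add_comm]
    congr 2 <;> exact if_congr and_comm rfl rfl

theorem symTridiagOf_add {k : ℕ} (d d' : Fin k → ℝ) (e e' : Fin (k - 1) → ℝ) :
    symTridiagOf (d + d') (e + e') = symTridiagOf d e + symTridiagOf d' e' := by
  ext a b
  simp only [symTridiagOf, Matrix.of_apply, Matrix.add_apply, Pi.add_apply]
  split_ifs <;> simp

theorem symTridiagOf_smul {k : ℕ} (c : ℝ) (d : Fin k → ℝ) (e : Fin (k - 1) → ℝ) :
    symTridiagOf (c • d) (c • e) = c • symTridiagOf d e := by
  ext a b
  simp only [symTridiagOf, Matrix.of_apply, Matrix.smul_apply, Pi.smul_apply]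
  split_ifs <;> simp

theorem measurable_symTridiagOf {k : ℕ} {Ω : Type*} [MeasurableSpace Ω] {d : Ω → Fin k → ℝ}
    {e : Ω → Fin (k - 1) → ℝ} (hd : Measurable d) (he : Measurable e) :
    Measurable fun ω => symTridiagOf (d ω) (e ω) := by
  refine measurable_pi_iff.2 fun a => measurable_pi_iff.2 fun b => ?_
  simp only [symTridiagOf, Matrix.of_apply]
  split_ifs <;> fun_prop

theorem symTridiagOf_mulVec {k : ℕ} (d : Fin k → ℝ) (e : Fin (k - 1) → ℝ) (v : Fin k → ℝ)
    (a : Fin k) :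
    (symTridiagOf d e *ᵥ v) a = d a * v a +
      ∑ l, e l * ((if a = finL l then v (finR l) else 0) +
        (if a = finR l then v (finL l) else 0)) := by
  simp only [Matrix.mulVec, dotProduct, symTridiagOf_apply_eq_sum, add_mul, Finset.sum_add_distrib,
    Finset.sum_mul]
  congr 1
  · simp
  · rw [Finset.sum_comm]
    refine Finset.sum_congr rfl fun l _ => ?_
    simp only [mul_assoc, add_mul, ← Finset.mul_sum, Finset.sum_add_distrib]
    congr 2
    · by_cases h : a = finL l <;> simp [h]
    · by_cases h : a = finR l <;> simp [h]

theorem dotProduct_symTridiagOf_mulVec {k : ℕ} (d : Fin k → ℝ) (e : Fin (k - 1) → ℝ)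
    (v : Fin k → ℝ) :
    v ⬝ᵥ (symTridiagOf d e *ᵥ v) =
      ∑ a, v a ^ 2 * d a + ∑ l, 2 * (v (finL l) * v (finR l)) * e l := by
  simp only [dotProduct, symTridiagOf_mulVec, mul_add, Finset.sum_add_distrib, Finset.mul_sum]
  congr 1
  · exact Finset.sum_congr rfl fun _ _ => by ring
  · rw [Finset.sum_comm, Finset.sum_comm (s := Finset.univ (α := Fin k)),
      ← Finset.sum_add_distrib]
    refine Finset.sum_congr rfl fun l _ => ?_
    simp only [mul_ite, mul_zero, Finset.sum_ite_eq', Finset.mem_univ, if_true]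
    ring

theorem mul_Hpoly (n : ℕ) (x : ℝ) :
    x * Hpoly n x = √(((n : ℝ) + 1) / 2) * Hpoly (n + 1) x + √((n : ℝ) / 2) * Hpoly (n - 1) x := by
  cases n with
  | zero =>
    simp only [Hpoly, Nat.cast_zero, zero_div, Real.sqrt_zero, zero_mul, add_zero, zero_add]
    have : √(1 / 2 : ℝ) * √2 = 1 := by rw [← Real.sqrt_mul (by norm_num)]; norm_num
    linear_combination (-x * Real.pi ^ (-(1 : ℝ) / 4)) * this
  | succ n =>
    have hpos : √(((n : ℝ) + 2) / 2) ≠ 0 := (Real.sqrt_pos.2 (by positivity)).ne'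
    simp only [Hpoly, Nat.cast_add, Nat.cast_one, Nat.add_sub_cancel]
    rw [show (n : ℝ) + 1 + 1 = n + 2 by ring]
    field_simp
    ring

/-- The eigenvector of `hermiteH k` at a root `x` of `Hpoly k`. -/
def hermiteVec (k : ℕ) (x : ℝ) (a : Fin k) : ℝ := Hpoly (k - 1 - a) x

theorem hermiteH_mulVec_hermiteVec {k : ℕ} {x : ℝ} (hx : Hpoly k x = 0) :
    hermiteH k *ᵥ hermiteVec k x = x • hermiteVec k x := by
  ext a
  have ha := a.isLt
  rw [hermiteH, symTridiagOf_mulVec, Pi.smul_apply, smul_eq_mul, zero_mul, zero_add, hermiteVec,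
    mul_Hpoly]
  simp only [mul_add, Finset.sum_add_distrib]
  rw [add_comm]
  have hcast : ((k - 1 - (a : ℕ) : ℕ) : ℝ) = (k : ℝ) - 1 - (a : ℕ) := by
    rw [Nat.cast_sub (by omega), Nat.cast_sub (by omega), Nat.cast_one]
  congr 1
  · rcases Nat.eq_zero_or_pos (a : ℕ) with h0 | hpos
    · rw [Finset.sum_eq_zero, h0, show k - 1 - 0 + 1 = k by omega, hx, mul_zero]
      intro l _
      rw [if_neg (by simp [Fin.ext_iff, finR]; omega), mul_zero]
    · rw [Finset.sum_eq_single ⟨a - 1, by omega⟩, if_pos (by simp [Fin.ext_iff, finR]; omega)]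
      · rw [← Real.sqrt_div' _ (by norm_num), hcast, hermiteVec]
        simp only [finL]
        rw [show k - 1 - ((a : ℕ) - 1) = k - 1 - (a : ℕ) + 1 by omega,
          Nat.cast_sub (by omega)]
        congr 3
        push_cast
        ring
      · intro l _ hl
        rw [Ne, Fin.ext_iff] at hl
        simp only at hl
        rw [if_neg (by simp [Fin.ext_iff, finR]; omega), mul_zero]
      · simp
  · by_cases hlast : (a : ℕ) + 1 = k
    · rw [Finset.sum_eq_zero, show k - 1 - (a : ℕ) = 0 by omega]
      · simp
      · intro l _
        have := l.isLt
        rw [if_neg (by simp [Fin.ext_iff, finL]; omega), mul_zero]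
    · rw [Finset.sum_eq_single ⟨a, by omega⟩, if_pos (by simp [finL])]
      · rw [← Real.sqrt_div' _ (by norm_num), hcast, hermiteVec]
        simp only [finR]
        rw [show k - 1 - ((a : ℕ) + 1) = k - 1 - (a : ℕ) - 1 by omega]
      · intro l _ hl
        rw [Ne, Fin.ext_iff] at hl
        simp only at hl
        rw [if_neg (by simp [Fin.ext_iff, finL]; omega), mul_zero]
      · simp

theorem sum_fin_reflect {k : ℕ} (f : ℕ → ℝ) :
    ∑ a : Fin k, f (k - 1 - a) = ∑ l ∈ Finset.range k, f l := by
  rw [Fin.sum_univ_eq_sum_range fun l => f (k - 1 - l), Finset.sum_range_reflect]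

theorem hermiteVec_dotProduct_self (k : ℕ) (x : ℝ) :
    hermiteVec k x ⬝ᵥ hermiteVec k x = ∑ l ∈ Finset.range k, Hpoly l x ^ 2 := by
  rw [← sum_fin_reflect fun l => Hpoly l x ^ 2]
  exact Finset.sum_congr rfl fun _ _ => (sq _).symm

theorem sum_Hpoly_sq_pos {k : ℕ} (hk : 1 ≤ k) (x : ℝ) :
    0 < ∑ l ∈ Finset.range k, Hpoly l x ^ 2 := by
  refine Finset.sum_pos' (fun _ _ => sq_nonneg _) ⟨0, Finset.mem_range.2 hk, ?_⟩
  exact pow_pos (Real.rpow_pos_of_pos Real.pi_pos _) 2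

theorem chiMeasure_univ {r : ℝ} (hr : 0 < r) : chiMeasure r Set.univ = 1 := by
  have hint := integral_rpow_mul_exp_neg_mul_rpow (p := 2) (q := r - 1) (b := 1 / 2)
    (by norm_num) (by linarith) (by norm_num)
  have hΓ := Real.Gamma_pos_of_pos (half_pos hr)
  have hfun : ∀ x ∈ Set.Ioi (0 : ℝ),
      (2:ℝ) ^ (1 - r / 2) * x ^ (r - 1) * Real.exp (-x ^ 2 / 2) / Real.Gamma (r / 2) =
      ((2:ℝ) ^ (1 - r / 2) / Real.Gamma (r / 2)) *
        (x ^ (r - 1) * Real.exp (-(1 / 2) * x ^ (2 : ℝ))) := by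
    intro x _
    rw [Real.rpow_two, show -(1 / 2) * x ^ 2 = -x ^ 2 / 2 by ring]
    ring
  have hval : ∫ x in Set.Ioi (0 : ℝ),
      (2:ℝ) ^ (1 - r / 2) * x ^ (r - 1) * Real.exp (-x ^ 2 / 2) / Real.Gamma (r / 2) = 1 := by
    rw [setIntegral_congr_fun measurableSet_Ioi hfun, integral_const_mul, hint,
      show (r - 1 + 1) / 2 = r / 2 by ring, show -(r - 1 + 1) / 2 = -(r / 2) by ring,
      one_div, Real.inv_rpow (by norm_num), ← Real.rpow_neg (by norm_num), neg_neg]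
    have h2 : (2 : ℝ) ^ (1 - r / 2) * 2 ^ (r / 2) = 2 := by
      rw [← Real.rpow_add (by norm_num)]; simp
    have hinv := mul_inv_cancel₀ hΓ.ne'
    rw [div_eq_mul_inv]
    generalize (2 : ℝ) ^ (1 - r / 2) = a at h2 ⊢
    generalize (2 : ℝ) ^ (r / 2) = b at h2 ⊢
    linear_combination (a * b / 2) * hinv + h2 / 2
  rw [chiMeasure, withDensity_apply _ MeasurableSet.univ, setLIntegral_univ,
    ← ofReal_integral_eq_lintegral_ofReal, integral_indicator measurableSet_Ioi, hval,
    ENNReal.ofReal_one]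
  · rw [integrable_indicator_iff measurableSet_Ioi]
    exact Integrable.of_integral_ne_zero (by rw [hval]; exact one_ne_zero)
  · refine Eventually.of_forall fun x => Set.indicator_nonneg (fun x hx => ?_) x
    have := Real.rpow_pos_of_pos (show (0 : ℝ) < x from hx) (r - 1)
    positivity

/-- The density, up to a constant factor, of `χ_(2s²) / √2 - s`. -/
def chiShift (s z : ℝ) : ℝ :=
  Set.indicator (Set.Ioi (-s))
    (fun z => Real.exp ((2 * s ^ 2 - 1) * Real.log (1 + z / s) - 2 * s * z - z ^ 2)) z

theorem measurable_chiShift (s : ℝ) : Measurable (chiShift s) := by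
  unfold chiShift
  exact Measurable.indicator (by fun_prop) measurableSet_Ioi

theorem chiShift_nonneg (s z : ℝ) : 0 ≤ chiShift s z :=
  Set.indicator_nonneg (fun _ _ => (Real.exp_pos _).le) _

theorem chiShift_le {s : ℝ} (hs : 1 ≤ s) (z : ℝ) :
    chiShift s z ≤ Real.exp (|z| - z ^ 2) := by
  rw [chiShift]
  by_cases hz : z ∈ Set.Ioi (-s)
  swap
  · rw [Set.indicator_of_notMem hz]
    exact (Real.exp_pos _).le
  rw [Set.indicator_of_mem hz]
  have hs0 : 0 < s := by linarith
  have hpos : 0 < 1 + z / s := by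
    have hz' : -s < z := hz
    rw [← neg_lt_iff_pos_add', lt_div_iff₀ hs0]
    linarith
  refine Real.exp_le_exp.2 ?_
  have hlog := Real.log_le_sub_one_of_pos hpos
  have h₁ : (2 * s ^ 2 - 1) * Real.log (1 + z / s) ≤ (2 * s ^ 2 - 1) * (z / s) :=
    mul_le_mul_of_nonneg_left (by linarith) (by nlinarith)
  have h₂ : (2 * s ^ 2 - 1) * (z / s) = 2 * s * z - z / s := by
    field_simp
  have h₃ : -(z / s) ≤ |z| := by
    calc -(z / s) ≤ |z / s| := neg_le_abs _
      _ = |z| / s := by rw [abs_div, abs_of_pos hs0]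
      _ ≤ |z| := div_le_self (abs_nonneg z) hs
  linarith

theorem integrable_exp_abs_sub_sq : Integrable fun z : ℝ => Real.exp (|z| - z ^ 2) := by
  have h : Integrable fun z : ℝ => Real.exp (1 / 2) * Real.exp (-(1 / 2) * z ^ 2) :=
    (integrable_exp_neg_mul_sq (by norm_num)).const_mul _
  refine h.mono' (by fun_prop) (Eventually.of_forall fun z => ?_)
  rw [Real.norm_eq_abs, abs_of_pos (Real.exp_pos _), ← Real.exp_add]
  refine Real.exp_le_exp.2 ?_
  nlinarith [sq_nonneg (|z| - 1), sq_abs z]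

theorem tendsto_chiShift (z : ℝ) :
    Tendsto (fun s => chiShift s z) atTop (𝓝 (Real.exp (-2 * z ^ 2))) := by
  have hdiv : Tendsto (fun s : ℝ => z / s) atTop (𝓝 0) := tendsto_const_nhds.div_atTop tendsto_id
  have hlog0 : Tendsto (fun s : ℝ => Real.log (1 + z / s)) atTop (𝓝 0) := by
    have := (Real.continuousAt_log (x := 1 + 0) (by norm_num)).tendsto.comp
      (hdiv.const_add 1)
    simpa [Function.comp_def] using this
  have hquad : Tendsto (fun s : ℝ => s ^ 2 * (Real.log (1 + z / s) - z / s)) atTop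
      (𝓝 (-z ^ 2 / 2)) := by
    rw [tendsto_iff_norm_sub_tendsto_zero]
    have hbound : Tendsto (fun s : ℝ => |z| ^ 3 / s / (1 - |z / s|)) atTop (𝓝 0) := by
      have h₁ : Tendsto (fun s : ℝ => |z| ^ 3 / s) atTop (𝓝 0) :=
        tendsto_const_nhds.div_atTop tendsto_id
      have h₂ : Tendsto (fun s : ℝ => 1 - |z / s|) atTop (𝓝 (1 - |0|)) := hdiv.abs.const_sub 1
      have h₃ : Tendsto (fun s : ℝ => |z| ^ 3 / s / (1 - |z / s|)) atTop (𝓝 (0 / (1 - |0|))) :=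
        h₁.div h₂ (by simp)
      simpa using h₃
    refine squeeze_zero' (Eventually.of_forall fun _ => norm_nonneg _) ?_ hbound
    filter_upwards [eventually_gt_atTop |z|, eventually_gt_atTop 0] with s hs hs0
    have hlt : |-(z / s)| < 1 := by
      rw [abs_neg, abs_div, abs_of_pos hs0, div_lt_one hs0]
      exact hs
    have := Real.abs_log_sub_add_sum_range_le hlt 2
    rw [abs_neg, sub_neg_eq_add] at this
    have heq : s ^ 2 * (Real.log (1 + z / s) - z / s) - -z ^ 2 / 2 =
        s ^ 2 * (∑ i ∈ Finset.range 2, (-(z / s)) ^ (i + 1) / ((i : ℝ) + 1) +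
          Real.log (1 + z / s)) := by
      simp only [Finset.sum_range_succ, Finset.sum_range_zero]
      push_cast
      field_simp
      ring
    rw [Real.norm_eq_abs, heq, abs_mul, abs_of_pos (pow_pos hs0 2)]
    calc _ ≤ s ^ 2 * (|z / s| ^ (2 + 1) / (1 - |z / s|)) :=
          mul_le_mul_of_nonneg_left this (sq_nonneg s)
      _ = |z| ^ 3 / s / (1 - |z / s|) := by
          rw [← mul_div_assoc]
          congr 1
          rw [abs_div, abs_of_pos hs0, div_pow]
          field_simp
  have hexp : Tendsto (fun s : ℝ => 2 * (s ^ 2 * (Real.log (1 + z / s) - z / s)) -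
      Real.log (1 + z / s) - z ^ 2) atTop (𝓝 (-2 * z ^ 2)) := by
    have := ((hquad.const_mul 2).sub hlog0).sub_const (z ^ 2)
    convert this using 2
    ring
  refine ((Real.continuous_exp.tendsto _).comp hexp).congr' ?_
  filter_upwards [eventually_gt_atTop (-z), eventually_gt_atTop 0] with s hs hs0
  have hmem : z ∈ Set.Ioi (-s) := by
    simp only [Set.mem_Ioi]; linarith
  rw [chiShift, Set.indicator_of_mem hmem, Function.comp_apply]
  congr 1
  field_simp
  ring

theorem tendsto_integral_chiShift :
    Tendsto (fun s => ∫ z, chiShift s z) atTop (𝓝 √(Real.pi / 2)) := by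
  rw [← integral_gaussian 2]
  refine tendsto_integral_filter_of_dominated_convergence (fun z => Real.exp (|z| - z ^ 2))
    (Eventually.of_forall fun s => (measurable_chiShift s).aestronglyMeasurable) ?_
    integrable_exp_abs_sub_sq (Eventually.of_forall tendsto_chiShift)
  filter_upwards [eventually_ge_atTop 1] with s hs
  refine Eventually.of_forall fun z => ?_
  rw [Real.norm_eq_abs, abs_of_nonneg (chiShift_nonneg s z)]
  exact chiShift_le hs z

/-- The density of `χ_(2s²) / √2 - s`. -/
def chiShiftPDF (s z : ℝ) : ℝ := chiShift s z / ∫ y, chiShift s y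

theorem chiShiftPDF_nonneg (s z : ℝ) : 0 ≤ chiShiftPDF s z :=
  div_nonneg (chiShift_nonneg s z) (integral_nonneg (chiShift_nonneg s))

theorem measurable_chiShiftPDF (s : ℝ) : Measurable (chiShiftPDF s) :=
  (measurable_chiShift s).div_const _

theorem tendsto_chiShiftPDF (z : ℝ) :
    Tendsto (fun s => chiShiftPDF s z) atTop (𝓝 (gaussianPDFReal 0 (1 / 4) z)) := by
  have hpos : √(Real.pi / 2) ≠ 0 := (Real.sqrt_pos.2 (by positivity)).ne'
  have hpdf : gaussianPDFReal 0 (1 / 4) z = Real.exp (-2 * z ^ 2) / √(Real.pi / 2) := by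
    have h14 : ((1 / 4 : NNReal) : ℝ) = 1 / 4 := by norm_num
    simp only [gaussianPDFReal_def, h14]
    rw [sub_zero, show 2 * Real.pi * (1 / 4) = Real.pi / 2 by ring,
      show -z ^ 2 / (2 * (1 / 4)) = -2 * z ^ 2 by ring, inv_mul_eq_div]
  rw [hpdf]
  exact (tendsto_chiShift z).div tendsto_integral_chiShift hpos

theorem eventually_chiShiftPDF_le :
    ∀ᶠ s in atTop, ∀ z, chiShiftPDF s z ≤ Real.exp (|z| - z ^ 2) := by
  have h1 : (1 : ℝ) < √(Real.pi / 2) := by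
    rw [Real.lt_sqrt zero_le_one]
    linarith [Real.pi_gt_three]
  filter_upwards [eventually_ge_atTop 1, tendsto_integral_chiShift.eventually_const_lt h1]
    with s hs hint z
  exact (div_le_self (chiShift_nonneg s z) hint.le).trans (chiShift_le hs z)

theorem map_chiMeasure_div_sqrt_two {s : ℝ} (hs : 0 < s) :
    Measure.map (fun x => x / √2) (chiMeasure (2 * s ^ 2)) =
      Measure.map (fun z => s + z)
        (volume.withDensity fun z => ENNReal.ofReal (chiShiftPDF s z)) := by
  have h2 : 0 < √(2 : ℝ) := by positivity
  have hr : 0 < 2 * s ^ 2 := by positivity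
  have hΓ := Real.Gamma_pos_of_pos (half_pos hr)
  set r := 2 * s ^ 2 with hr_def
  set φ : ℝ → ℝ := Set.indicator (Set.Ioi (0:ℝ))
      (fun x => (2:ℝ) ^ (1 - r / 2) * x ^ (r - 1) * Real.exp (-x ^ 2 / 2) / Real.Gamma (r / 2))
    with hφ
  have hφm : Measurable φ := Measurable.indicator (by fun_prop) measurableSet_Ioi
  have hvol : (volume : Measure ℝ) =
      ENNReal.ofReal √2 • Measure.map (fun z => √2 * (s + z)) volume := by
    have hcomp : (fun z : ℝ => √2 * (s + z)) = (fun z => √2 * z) ∘ fun z => s + z := rfl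
    rw [hcomp, ← Measure.map_map (by fun_prop) (by fun_prop),
      (measurePreserving_add_left volume s).map_eq]
    simpa [abs_of_pos h2] using (Real.smul_map_volume_mul_left h2.ne').symm
  obtain ⟨C, hC, hφC⟩ : ∃ C, 0 ≤ C ∧ ∀ z, √2 * φ (√2 * (s + z)) = C * chiShift s z := by
    refine ⟨√2 * ((2:ℝ) ^ (1 - r / 2) * (√2 * s) ^ (r - 1) * Real.exp (-s ^ 2) /
      Real.Gamma (r / 2)), by positivity, fun z => ?_⟩
    by_cases hz : -s < z
    · have hsz : 0 < s + z := by linarith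
      have hmem : √2 * (s + z) ∈ Set.Ioi (0 : ℝ) := mul_pos h2 hsz
      have hone : 0 < 1 + z / s := by
        rw [show 1 + z / s = (s + z) / s by field_simp]; positivity
      rw [chiShift, hφ, Set.indicator_of_mem hmem, Set.indicator_of_mem (Set.mem_Ioi.2 hz),
        show √2 * (s + z) = √2 * s * (1 + z / s) by field_simp,
        Real.mul_rpow (by positivity) hone.le, Real.rpow_def_of_pos hone,
        show (2 * s ^ 2 - 1) * Real.log (1 + z / s) - 2 * s * z - z ^ 2 =
          Real.log (1 + z / s) * (r - 1) + (-2 * s * z - z ^ 2) by rw [hr_def]; ring,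
        Real.exp_add _ (-2 * s * z - z ^ 2),
        show -(√2 * s * (1 + z / s)) ^ 2 / 2 = -s ^ 2 + (-2 * s * z - z ^ 2) by
          rw [mul_pow, mul_pow, Real.sq_sqrt (by norm_num)]
          field_simp
          ring,
        Real.exp_add (-s ^ 2)]
      ring
    · have hnm : √2 * (s + z) ∉ Set.Ioi (0 : ℝ) := by
        simp only [Set.mem_Ioi, not_lt] at hz ⊢
        exact mul_nonpos_of_nonneg_of_nonpos h2.le (by linarith)
      rw [chiShift, hφ, Set.indicator_of_notMem hnm, Set.indicator_of_notMem (by simpa using hz),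
        mul_zero, mul_zero]
  have hlint : ∀ B : Set ℝ, MeasurableSet B →
      Measure.map (fun x => x / √2) (chiMeasure r) B =
        ∫⁻ z in (fun z => s + z) ⁻¹' B, ENNReal.ofReal (C * chiShift s z) := by
    intro B hB
    have hB' : MeasurableSet ((fun x : ℝ => x / √2) ⁻¹' B) := (measurable_id.div_const _) hB
    rw [Measure.map_apply (by fun_prop) hB, chiMeasure, withDensity_apply _ hB',
      ← lintegral_indicator hB']
    change ∫⁻ x, _ ∂volume = _
    conv_lhs => rw [hvol]
    rw [lintegral_smul_measure, lintegral_map (hφm.ennreal_ofReal.indicator hB')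
      (by fun_prop), smul_eq_mul, ← lintegral_const_mul' _ _ ENNReal.ofReal_ne_top,
      ← lintegral_indicator ((by fun_prop : Measurable fun z : ℝ => s + z) hB)]
    refine lintegral_congr fun z => ?_
    have hiff : √2 * (s + z) ∈ (fun x : ℝ => x / √2) ⁻¹' B ↔ z ∈ (fun z => s + z) ⁻¹' B := by
      simp only [Set.mem_preimage]
      rw [mul_div_cancel_left₀ _ h2.ne']
    by_cases hz : z ∈ (fun z => s + z) ⁻¹' B
    · rw [Set.indicator_of_mem (hiff.2 hz), Set.indicator_of_mem hz, ← hφC,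
        ENNReal.ofReal_mul h2.le]
    · rw [Set.indicator_of_notMem (mt hiff.1 hz), Set.indicator_of_notMem hz, mul_zero]
  have htot : ∫⁻ z, ENNReal.ofReal (C * chiShift s z) = 1 := by
    have := hlint Set.univ MeasurableSet.univ
    rw [Measure.map_apply (by fun_prop) MeasurableSet.univ, Set.preimage_univ,
      chiMeasure_univ hr, Set.preimage_univ, setLIntegral_univ] at this
    exact this.symm
  have hint : C * ∫ z, chiShift s z = 1 := by
    rw [← integral_const_mul, integral_eq_lintegral_of_nonneg_ae
      (Eventually.of_forall fun z => mul_nonneg hC (chiShift_nonneg s z))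
      ((measurable_chiShift s).const_mul C).aestronglyMeasurable, htot, ENNReal.toReal_one]
  ext B hB
  rw [hlint B hB, Measure.map_apply (by fun_prop) hB,
    withDensity_apply _ ((by fun_prop : Measurable fun z : ℝ => s + z) hB)]
  refine lintegral_congr fun z => ?_
  rw [chiShiftPDF, div_eq_inv_mul, eq_inv_of_mul_eq_one_left hint]

theorem pi_withDensity_ofReal {ι : Type*} [Fintype ι] {ρ : ι → ℝ → ℝ}
    (hnonneg : ∀ i z, 0 ≤ ρ i z) (hint : ∀ i, Integrable (ρ i)) :
    Measure.pi (fun i => volume.withDensity fun z => ENNReal.ofReal (ρ i z)) =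
      (volume : Measure (ι → ℝ)).withDensity fun z => ENNReal.ofReal (∏ i, ρ i (z i)) := by
  have hfin : ∀ i, IsFiniteMeasure (volume.withDensity fun z => ENNReal.ofReal (ρ i z)) := fun i =>
    isFiniteMeasure_withDensity_ofReal (hint i).2
  refine Measure.pi_eq fun s hs => ?_
  rw [withDensity_apply _ (MeasurableSet.univ_pi hs), volume_pi, Measure.restrict_pi_pi,
    ← ofReal_integral_eq_lintegral_ofReal, integral_fintype_prod_eq_prod,
    ENNReal.ofReal_prod_of_nonneg fun i _ => integral_nonneg (hnonneg i)]
  · refine Finset.prod_congr rfl fun i _ => ?_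
    rw [withDensity_apply _ (hs i), ofReal_integral_eq_lintegral_ofReal (hint i).restrict
      (Eventually.of_forall (hnonneg i))]
  · exact Integrable.fintype_prod fun i => (hint i).restrict
  · exact Eventually.of_forall fun z => Finset.prod_nonneg fun i _ => hnonneg i _

theorem integral_prod_pi_withDensity {X ι : Type*} [MeasurableSpace X] [Fintype ι]
    (γ : Measure X) [IsProbabilityMeasure γ] {ρ : ι → ℝ → ℝ} (hmeas : ∀ i, Measurable (ρ i))
    (hnonneg : ∀ i z, 0 ≤ ρ i z) (hint : ∀ i, Integrable (ρ i)) (F : X × (ι → ℝ) → ℝ) :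
    ∫ p, F p ∂(γ.prod (Measure.pi fun i => volume.withDensity fun z => ENNReal.ofReal (ρ i z))) =
      ∫ p : X × (ι → ℝ), (∏ i, ρ i (p.2 i)) * F p ∂(γ.prod volume) := by
  have hprod : Measurable fun z : ι → ℝ => ENNReal.ofReal (∏ i, ρ i (z i)) := by fun_prop
  have hprod' : Measurable fun p : X × (ι → ℝ) => ENNReal.ofReal (∏ i, ρ i (p.2 i)) :=
    hprod.comp measurable_snd
  have hfin : IsFiniteMeasure
      ((volume : Measure (ι → ℝ)).withDensity fun z => ENNReal.ofReal (∏ i, ρ i (z i))) :=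
    isFiniteMeasure_withDensity_ofReal (Integrable.fintype_prod (μ := fun _ => volume) hint).2
  rw [pi_withDensity_ofReal hnonneg hint, prod_withDensity_right hprod,
    integral_withDensity_eq_integral_toReal_smul hprod'
      (Eventually.of_forall fun _ => ENNReal.ofReal_lt_top)]
  refine integral_congr_ae (Eventually.of_forall fun p => ?_)
  simp only [smul_eq_mul]
  rw [ENNReal.toReal_ofReal (Finset.prod_nonneg fun i _ => hnonneg i _)]

theorem tendsto_integral_prod_pi_withDensity {X ι : Type*} [MeasurableSpace X] [Fintype ι]
    (γ : Measure X) [IsProbabilityMeasure γ] {l : Filter ℝ} [l.IsCountablyGenerated]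
    {ρ : ℝ → ι → ℝ → ℝ} {ρ₀ : ι → ℝ → ℝ} {g : ℝ → ℝ}
    (hmeas : ∀ b i, Measurable (ρ b i)) (hmeas₀ : ∀ i, Measurable (ρ₀ i))
    (hnonneg : ∀ b i z, 0 ≤ ρ b i z) (hnonneg₀ : ∀ i z, 0 ≤ ρ₀ i z)
    (hint₀ : ∀ i, Integrable (ρ₀ i)) (hg : Integrable g)
    (hle : ∀ i, ∀ᶠ b in l, ∀ z, ρ b i z ≤ g z)
    (hlim : ∀ i z, Tendsto (fun b => ρ b i z) l (𝓝 (ρ₀ i z)))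
    {F : ℝ → X × (ι → ℝ) → ℝ} {F₀ : X × (ι → ℝ) → ℝ} {C : ℝ}
    (hF : ∀ b, Measurable (F b)) (hC : ∀ b p, |F b p| ≤ C)
    (hFlim : ∀ p, Tendsto (fun b => F b p) l (𝓝 (F₀ p))) :
    Tendsto (fun b => ∫ p, F b p
      ∂(γ.prod (Measure.pi fun i => volume.withDensity fun z => ENNReal.ofReal (ρ b i z)))) l
      (𝓝 (∫ p, F₀ p
        ∂(γ.prod (Measure.pi fun i => volume.withDensity fun z => ENNReal.ofReal (ρ₀ i z))))) := by
  rw [integral_prod_pi_withDensity γ hmeas₀ hnonneg₀ hint₀]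
  have hle' : ∀ᶠ b in l, ∀ i z, ρ b i z ≤ g z := eventually_all.2 hle
  have hlim' : Tendsto (fun b => ∫ p : X × (ι → ℝ), (∏ i, ρ b i (p.2 i)) * F b p ∂(γ.prod volume)) l
      (𝓝 (∫ p : X × (ι → ℝ), (∏ i, ρ₀ i (p.2 i)) * F₀ p ∂(γ.prod volume))) := by
    refine tendsto_integral_filter_of_dominated_convergence
      (fun p : X × (ι → ℝ) => 1 * ((∏ i, g (p.2 i)) * C)) ?_ ?_ ?_ ?_
    · exact Eventually.of_forall fun b => (by fun_prop : Measurable _).aestronglyMeasurable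
    · filter_upwards [hle'] with b hb
      refine Eventually.of_forall fun p => ?_
      rw [one_mul, Real.norm_eq_abs, abs_mul,
        abs_of_nonneg (Finset.prod_nonneg fun i _ => hnonneg b i _)]
      exact mul_le_mul (Finset.prod_le_prod (fun i _ => hnonneg b i _) fun i _ => hb i _) (hC b p)
        (abs_nonneg _) (Finset.prod_nonneg fun i _ => (hnonneg b i _).trans (hb i _))
    · exact (integrable_const (1 : ℝ)).mul_prod
        ((Integrable.fintype_prod (μ := fun _ => volume) fun _ : ι => hg).mul_const C)
    · exact Eventually.of_forall fun p => (tendsto_finsetProd _ fun i _ => hlim i _).mul (hFlim p)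
  refine hlim'.congr' ?_
  filter_upwards [hle'] with b hb
  refine (integral_prod_pi_withDensity γ (hmeas b) (hnonneg b) (fun i => ?_) (F b)).symm
  refine hg.mono' (hmeas b i).aestronglyMeasurable (Eventually.of_forall fun z => ?_)
  rw [Real.norm_eq_abs, abs_of_nonneg (hnonneg b i z)]
  exact hb i z

theorem map_pi_gaussianReal_linear {ι : Type*} [Fintype ι] (v : NNReal) (a : ι → ℝ) :
    Measure.map (fun x : ι → ℝ => ∑ i, a i * x i) (Measure.pi fun _ => gaussianReal 0 v) =
      gaussianReal 0 (v * (∑ i, a i ^ 2).toNNReal) := by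
  have hm : Measurable fun x : ι → ℝ => ∑ i, a i * x i := by fun_prop
  have : IsProbabilityMeasure
      (Measure.map (fun x : ι → ℝ => ∑ i, a i * x i) (Measure.pi fun _ => gaussianReal 0 v)) :=
    Measure.isProbabilityMeasure_map hm.aemeasurable
  refine Measure.ext_of_charFun (funext fun t => ?_)
  rw [charFun_apply_real, integral_map hm.aemeasurable (by fun_prop), charFun_gaussianReal]
  have hexp : ∀ x : ι → ℝ, Complex.exp (t * ((∑ i, a i * x i : ℝ) : ℂ) * Complex.I) =
      ∏ i, Complex.exp ((t * a i : ℝ) * (x i : ℂ) * Complex.I) := by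
    intro x
    rw [← Complex.exp_sum]
    congr 1
    push_cast
    rw [Finset.mul_sum, Finset.sum_mul]
    exact Finset.sum_congr rfl fun i _ => by ring
  simp_rw [hexp]
  rw [integral_fintype_prod_eq_prod
    (f := fun i (y : ℝ) => Complex.exp ((t * a i : ℝ) * (y : ℂ) * Complex.I))]
  simp_rw [← charFun_apply_real, charFun_gaussianReal]
  rw [← Complex.exp_sum]
  congr 1
  simp only [NNReal.coe_mul, Real.coe_toNNReal _ (Finset.sum_nonneg fun i _ => sq_nonneg (a i))]
  push_cast
  rw [Finset.sum_sub_distrib, mul_assoc (v : ℂ), Finset.sum_mul, Finset.mul_sum, Finset.sum_div]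
  simp only [mul_zero, zero_mul, Finset.sum_const_zero, zero_sub, neg_inj]
  exact Finset.sum_congr rfl fun i _ => by ring

theorem map_prod_pi_gaussianReal_linear {ι κ : Type*} [Fintype ι] [Fintype κ] (v w : NNReal)
    (a : ι → ℝ) (b : κ → ℝ) :
    Measure.map (fun p : (ι → ℝ) × (κ → ℝ) => ∑ i, a i * p.1 i + ∑ l, b l * p.2 l)
      ((Measure.pi fun _ => gaussianReal 0 v).prod (Measure.pi fun _ => gaussianReal 0 w)) =
      gaussianReal 0 (v * ∑ i, a i ^ 2 + w * ∑ l, b l ^ 2).toNNReal := by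
  have hcomp : (fun p : (ι → ℝ) × (κ → ℝ) => ∑ i, a i * p.1 i + ∑ l, b l * p.2 l) =
      (fun q : ℝ × ℝ => q.1 + q.2) ∘
        Prod.map (fun x => ∑ i, a i * x i) (fun y => ∑ l, b l * y l) := rfl
  rw [hcomp, ← Measure.map_map (by fun_prop) (by fun_prop),
    ← Measure.map_prod_map _ _ (by fun_prop) (by fun_prop), map_pi_gaussianReal_linear,
    map_pi_gaussianReal_linear]
  change gaussianReal 0 _ ∗ gaussianReal 0 _ = _
  rw [gaussianReal_conv_gaussianReal, add_zero,
    Real.toNNReal_add (mul_nonneg v.coe_nonneg (Finset.sum_nonneg fun i _ => sq_nonneg _))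
      (mul_nonneg w.coe_nonneg (Finset.sum_nonneg fun i _ => sq_nonneg _)),
    Real.toNNReal_mul v.coe_nonneg, Real.toNNReal_mul w.coe_nonneg, Real.toNNReal_coe,
    Real.toNNReal_coe]

/-- The first-order variation of the eigenvalues of `hermiteH k` in the direction
`symTridiagOf p.1 p.2`. -/
def hermiteLimit {k : ℕ} (h : Fin k → ℝ) (p : (Fin k → ℝ) × (Fin (k - 1) → ℝ)) (i : Fin k) : ℝ :=
  hermiteVec k (h i) ⬝ᵥ (symTridiagOf p.1 p.2 *ᵥ hermiteVec k (h i)) /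
    (hermiteVec k (h i) ⬝ᵥ hermiteVec k (h i))

theorem measurable_hermiteLimit {k : ℕ} (h : Fin k → ℝ) : Measurable (hermiteLimit h) := by
  refine measurable_pi_iff.2 fun i => ?_
  simp only [hermiteLimit, dotProduct_symTridiagOf_mulVec]
  fun_prop

theorem hermCov_eq {k : ℕ} (h : Fin k → ℝ) (i j : Fin k) :
    hermCov k h i j =
      (∑ a, hermiteVec k (h i) a ^ 2 * hermiteVec k (h j) a ^ 2 +
        ∑ l, (hermiteVec k (h i) (finL l) * hermiteVec k (h i) (finR l)) *
          (hermiteVec k (h j) (finL l) * hermiteVec k (h j) (finR l))) /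
      ((hermiteVec k (h i) ⬝ᵥ hermiteVec k (h i)) *
        (hermiteVec k (h j) ⬝ᵥ hermiteVec k (h j))) := by
  rw [hermCov, hermiteVec_dotProduct_self, hermiteVec_dotProduct_self,
    ← sum_fin_reflect fun l => Hpoly l (h i) ^ 2 * Hpoly l (h j) ^ 2,
    ← sum_fin_reflect fun l =>
      Hpoly (l + 1) (h i) * Hpoly l (h i) * Hpoly (l + 1) (h j) * Hpoly l (h j)]
  congr 2
  refine Finset.sum_congr rfl fun l _ => ?_
  have hl := l.isLt
  simp only [hermiteVec, finL, finR]
  rw [show k - 1 - 1 - (l : ℕ) + 1 = k - 1 - l by omega,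
    show k - 1 - 1 - (l : ℕ) = k - 1 - (l + 1) by omega]
  ring

theorem sum_sum_sum_mul_eq_sum_sq {ι κ : Type*} [Fintype ι] [Fintype κ] (f : ι → κ → ℝ) :
    ∑ i, ∑ j, ∑ a, f i a * f j a = ∑ a, (∑ i, f i a) ^ 2 := by
  simp only [sq, Finset.sum_mul_sum]
  rw [Finset.sum_comm (s := Finset.univ (α := κ))]
  exact Finset.sum_congr rfl fun i _ => Finset.sum_comm

theorem sum_mul_hermCov {k : ℕ} (h c : Fin k → ℝ) (q : Fin k → ℝ)
    (hq : ∀ i, q i = c i / (hermiteVec k (h i) ⬝ᵥ hermiteVec k (h i))) :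
    ∑ i, ∑ j, c i * c j * hermCov k h i j =
      ∑ a, (∑ i, q i * hermiteVec k (h i) a ^ 2) ^ 2 +
        1 / 4 * ∑ l, (∑ i, q i *
          (2 * (hermiteVec k (h i) (finL l) * hermiteVec k (h i) (finR l)))) ^ 2 := by
  have hterm : ∀ i j, c i * c j * hermCov k h i j =
      ∑ a, (q i * hermiteVec k (h i) a ^ 2) * (q j * hermiteVec k (h j) a ^ 2) +
        1 / 4 * ∑ l,
          ((q i * (2 * (hermiteVec k (h i) (finL l) * hermiteVec k (h i) (finR l)))) *
          (q j * (2 * (hermiteVec k (h j) (finL l) * hermiteVec k (h j) (finR l))))) := by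
    intro i j
    rw [hermCov_eq, mul_comm, div_mul_eq_mul_div, mul_div_assoc, ← div_mul_div_comm, ← hq, ← hq,
      add_mul, Finset.sum_mul, Finset.sum_mul, Finset.mul_sum]
    congr 1 <;> exact Finset.sum_congr rfl fun _ _ => by ring
  simp only [hterm, Finset.sum_add_distrib, ← Finset.mul_sum]
  rw [sum_sum_sum_mul_eq_sum_sq, sum_sum_sum_mul_eq_sum_sq fun i l => q i *
    (2 * (hermiteVec k (h i) (finL l) * hermiteVec k (h i) (finR l)))]

/-- The law of the limiting fluctuations, before scaling. -/
theorem isCenteredGaussianVec_map_hermiteLimit {k : ℕ} (h : Fin k → ℝ) :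
    IsCenteredGaussianVec
      (Measure.map (hermiteLimit h) ((Measure.pi fun _ : Fin k => gaussianReal 0 1).prod
        (Measure.pi fun _ : Fin (k - 1) => gaussianReal 0 (1 / 4)))) (hermCov k h) := by
  refine ⟨Measure.isProbabilityMeasure_map (measurable_hermiteLimit h).aemeasurable, fun c => ?_⟩
  rw [Measure.map_map (by fun_prop) (measurable_hermiteLimit h)]
  set q : Fin k → ℝ := fun i => c i / (hermiteVec k (h i) ⬝ᵥ hermiteVec k (h i)) with hq
  have hlin : (fun x : Fin k → ℝ => ∑ i, c i * x i) ∘ hermiteLimit h = fun p =>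
      ∑ a, (∑ i, q i * hermiteVec k (h i) a ^ 2) * p.1 a +
        ∑ l, (∑ i, q i *
          (2 * (hermiteVec k (h i) (finL l) * hermiteVec k (h i) (finR l)))) * p.2 l := by
    funext p
    simp only [Function.comp_apply, hermiteLimit, dotProduct_symTridiagOf_mulVec, Finset.sum_mul]
    rw [Finset.sum_comm, Finset.sum_comm (s := Finset.univ (α := Fin (k - 1))),
      ← Finset.sum_add_distrib]
    refine Finset.sum_congr rfl fun i _ => ?_
    rw [mul_div_assoc', mul_comm, ← mul_div_assoc', add_mul, Finset.sum_mul, Finset.sum_mul]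
    congr 1 <;> exact Finset.sum_congr rfl fun _ _ => by rw [hq]; ring
  rw [hlin, map_prod_pi_gaussianReal_linear, sum_mul_hermCov h c q fun _ => rfl]
  norm_num

/-- The rescaled eigenvalue deviations are measurable on the set of symmetric matrices. -/
theorem aemeasurable_scaled_ithLargestEig {k : ℕ} {Ω : Type*} [MeasurableSpace Ω] {μ : Measure Ω}
    {M : Ω → Matrix (Fin k) (Fin k) ℝ} (hM : Measurable M) (hsymm : ∀ ω, (M ω).IsHermitian)
    (c : ℝ) (b : Fin k → ℝ) :
    AEMeasurable (fun A i => c * (ithLargestEig A i - b i)) (Measure.map M μ) := by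
  have hsym : Measurable fun A : Matrix (Fin k) (Fin k) ℝ => (1 / 2 : ℝ) • (A + Aᵀ) := by
    refine measurable_pi_iff.2 fun i => measurable_pi_iff.2 fun j => ?_
    simp only [Matrix.smul_apply, Matrix.add_apply, Matrix.transpose_apply]
    fun_prop
  have hherm : ∀ A : Matrix (Fin k) (Fin k) ℝ, ((1 / 2 : ℝ) • (A + Aᵀ)).IsHermitian := by
    intro A
    ext i j
    simp only [Matrix.conjTranspose_apply, Matrix.smul_apply, Matrix.add_apply,
      Matrix.transpose_apply, star_trivial, add_comm]
  have : MeasurableEq (Matrix (Fin k) (Fin k) ℝ) :=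
    inferInstanceAs (MeasurableEq (Fin k → Fin k → ℝ))
  have hset : MeasurableSet {A : Matrix (Fin k) (Fin k) ℝ | (1 / 2 : ℝ) • (A + Aᵀ) = A} :=
    measurableSet_eq_fun hsym measurable_id
  have hmeas : Measurable fun (A : Matrix (Fin k) (Fin k) ℝ) i =>
      c * (ithLargestEig ((1 / 2 : ℝ) • (A + Aᵀ)) i - b i) :=
    measurable_pi_iff.2 fun i =>
      ((measurable_pi_iff.1 (measurable_ithLargestEig hsym hherm) i).sub_const _).const_mul _
  refine ⟨_, hmeas, ?_⟩
  have hae : ∀ᵐ A ∂Measure.map M μ, (1 / 2 : ℝ) • (A + Aᵀ) = A := by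
    rw [ae_map_iff hM.aemeasurable hset]
    refine Eventually.of_forall fun ω => ?_
    ext i j
    have := (hsymm ω).apply i j
    rw [star_trivial] at this
    simp only [Matrix.smul_apply, Matrix.add_apply, Matrix.transpose_apply, smul_eq_mul, this]
    ring
  filter_upwards [hae] with A hA
  rw [hA]

/-- The off-diagonal entries `√β • e + z` and the scale `1/√(2kβ)` amount to the perturbation
`(1/√(2k)) • (hermiteH k + (1/√β) • symTridiagOf d z)`. -/
theorem smul_symTridiagOf_eq_perturbation {k : ℕ} {β : ℝ} (hβ : 0 < β) (d : Fin k → ℝ)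
    (z : Fin (k - 1) → ℝ) :
    (√(2 * (k : ℝ) * β))⁻¹ •
      symTridiagOf d (fun j => √β * (√((k : ℝ) - 1 - (j : ℕ)) / √2) + z j) =
      (√(2 * (k : ℝ)))⁻¹ • (hermiteH k + (√β)⁻¹ • symTridiagOf d z) := by
  have hs : √β ≠ 0 := (Real.sqrt_pos.2 hβ).ne'
  have hsplit : symTridiagOf d (fun j => √β * (√((k : ℝ) - 1 - (j : ℕ)) / √2) + z j) =
      √β • hermiteH k + symTridiagOf d z := by
    rw [hermiteH, ← symTridiagOf_smul, ← symTridiagOf_add]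
    congr 1
    funext a
    simp
  rw [hsplit, Real.sqrt_mul (by positivity), mul_inv, mul_smul, smul_add, smul_smul,
    inv_mul_cancel₀ hs, one_smul]

/-- The expectation of `f` at the rescaled eigenvalue deviations, written over the Gaussian diagonal
and the recentred off-diagonal entries. -/
theorem integral_hermiteLaw {k : ℕ} {β : ℝ} (hβ : 0 < β) (b : Fin k → ℝ)
    (f : BoundedContinuousFunction (Fin k → ℝ) ℝ) :
    ∫ x, f x ∂(Measure.map (fun A i => √β * (ithLargestEig A i - b i)) (hermiteLaw k β)) =
      ∫ p, f (fun i => √β * (ithLargestEig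
          ((√(2 * (k : ℝ)))⁻¹ • (hermiteH k + (√β)⁻¹ • symTridiagOf p.1 p.2)) i - b i))
        ∂((Measure.pi fun _ : Fin k => gaussianReal 0 1).prod
          (Measure.pi fun j : Fin (k - 1) => volume.withDensity fun z =>
            ENNReal.ofReal (chiShiftPDF (√β * (√((k : ℝ) - 1 - (j : ℕ)) / √2)) z))) := by
  set s : Fin (k - 1) → ℝ := fun j => √β * (√((k : ℝ) - 1 - (j : ℕ)) / √2) with hs
  have hpos : ∀ j : Fin (k - 1), 0 < (k : ℝ) - 1 - (j : ℕ) := by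
    intro j
    have hj : (j : ℕ) + 1 < k := by have := j.isLt; omega
    have : ((j : ℕ) : ℝ) + 1 < k := by exact_mod_cast hj
    linarith
  have hspos : ∀ j, 0 < s j := fun j =>
    mul_pos (Real.sqrt_pos.2 hβ) (div_pos (Real.sqrt_pos.2 (hpos j)) (by positivity))
  have hparam : ∀ j : Fin (k - 1), ((k : ℝ) - 1 - (j : ℕ)) * β = 2 * s j ^ 2 := by
    intro j
    rw [hs]
    simp only [mul_pow, div_pow]
    rw [Real.sq_sqrt hβ.le, Real.sq_sqrt (hpos j).le, Real.sq_sqrt zero_le_two]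
    ring
  have hlaw : ∀ j : Fin (k - 1),
      Measure.map (fun x => x / √2) (chiMeasure (((k : ℝ) - 1 - (j : ℕ)) * β)) =
        Measure.map (fun z => s j + z)
          (volume.withDensity fun z => ENNReal.ofReal (chiShiftPDF (s j) z)) := by
    intro j
    rw [hparam j, map_chiMeasure_div_sqrt_two (hspos j)]
  have hprob : ∀ j : Fin (k - 1), IsProbabilityMeasure (Measure.map (fun z => s j + z)
      (volume.withDensity fun z => ENNReal.ofReal (chiShiftPDF (s j) z))) := by
    intro j
    rw [← hlaw j, hparam j]
    have : IsProbabilityMeasure (chiMeasure (2 * s j ^ 2)) :=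
      ⟨chiMeasure_univ (by have := hspos j; positivity)⟩
    exact Measure.isProbabilityMeasure_map (by fun_prop)
  have hM : Measurable fun p : (Fin k → ℝ) × (Fin (k - 1) → ℝ) =>
      (√(2 * (k : ℝ) * β))⁻¹ • symTridiagOf p.1 p.2 := by
    simp only [← symTridiagOf_smul]
    exact measurable_symTridiagOf (by fun_prop) (by fun_prop)
  have hsymm : ∀ p : (Fin k → ℝ) × (Fin (k - 1) → ℝ),
      ((√(2 * (k : ℝ) * β))⁻¹ • symTridiagOf p.1 p.2).IsHermitian := by
    intro p
    rw [← symTridiagOf_smul]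
    exact symTridiagOf_isHermitian _ _
  have hτ : Measurable fun p : (Fin k → ℝ) × (Fin (k - 1) → ℝ) =>
      Prod.map id (fun (z : Fin (k - 1) → ℝ) j => s j + z j) p := by fun_prop
  have hG : Measurable ((fun (A : Matrix (Fin k) (Fin k) ℝ) i => √β * (ithLargestEig A i - b i)) ∘
      fun p : (Fin k → ℝ) × (Fin (k - 1) → ℝ) =>
        (√(2 * (k : ℝ) * β))⁻¹ • symTridiagOf p.1 p.2) :=
    measurable_pi_iff.2 fun i =>
      ((measurable_pi_iff.1 (measurable_ithLargestEig hM hsymm) i).sub_const _).const_mul _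
  have hprod : (Measure.pi fun _ : Fin k => gaussianReal 0 1).prod
      (Measure.pi fun j : Fin (k - 1) =>
        Measure.map (fun x => x / √2) (chiMeasure (((k : ℝ) - 1 - (j : ℕ)) * β))) =
      Measure.map (fun p => Prod.map id (fun (z : Fin (k - 1) → ℝ) j => s j + z j) p)
        ((Measure.pi fun _ : Fin k => gaussianReal 0 1).prod
          (Measure.pi fun j : Fin (k - 1) => volume.withDensity fun z =>
            ENNReal.ofReal (chiShiftPDF (s j) z))) := by
    simp only [hlaw]
    rw [← Measure.pi_map_pi (fun j => by fun_prop)]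
    conv_lhs => rw [← Measure.map_id (μ := Measure.pi fun _ : Fin k => gaussianReal 0 1)]
    exact Measure.map_prod_map _ _ measurable_id (by fun_prop)
  rw [hermiteLaw, AEMeasurable.map_map_of_aemeasurable
    (aemeasurable_scaled_ithLargestEig hM hsymm _ _) hM.aemeasurable,
    integral_map hG.aemeasurable f.continuous.aestronglyMeasurable, hprod,
    integral_map hτ.aemeasurable
      (show Measurable fun p => f (_ : Fin k → ℝ) from
        f.continuous.measurable.comp hG).aestronglyMeasurable]
  refine integral_congr_ae (Eventually.of_forall fun p => ?_)
  simp only [Function.comp_apply, Prod.map_fst, Prod.map_snd, id, hs,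
    smul_symTridiagOf_eq_perturbation hβ]

theorem gaussianReal_eq_withDensity_ofReal :
    gaussianReal 0 (1 / 4) =
      volume.withDensity fun z => ENNReal.ofReal (gaussianPDFReal 0 (1 / 4) z) := by
  rw [gaussianReal_of_var_ne_zero _ (by norm_num)]
  rfl

/-- Pointwise convergence of the rescaled eigenvalue deviations. -/
theorem tendsto_scaled_ithLargestEig {k : ℕ} (hk : 1 ≤ k) {h : Fin k → ℝ} (hanti : StrictAnti h)
    (hroot : ∀ i, Hpoly k (h i) = 0) (p : (Fin k → ℝ) × (Fin (k - 1) → ℝ)) :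
    Tendsto (fun (β : ℝ) i => √β * (ithLargestEig
          ((√(2 * (k : ℝ)))⁻¹ • (hermiteH k + (√β)⁻¹ • symTridiagOf p.1 p.2)) i -
            h i / √(2 * (k : ℝ)))) atTop
      (𝓝 ((√(2 * (k : ℝ)))⁻¹ • hermiteLimit h p)) := by
  have hκ : 0 < (√(2 * (k : ℝ)))⁻¹ := by
    have : (0 : ℝ) < k := by exact_mod_cast hk
    positivity
  have ht : Tendsto (fun β : ℝ => (√β)⁻¹) atTop (𝓝[>] 0) :=
    tendsto_inv_atTop_nhdsGT_zero.comp Real.tendsto_sqrt_atTop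
  refine tendsto_pi_nhds.2 fun i => ?_
  have := (tendsto_ithLargestEig_perturbation (H := hermiteH k) (symTridiagOf_isHermitian _ _)
    (symTridiagOf_isHermitian p.1 p.2) hanti (v := fun i => hermiteVec k (h i))
    (fun i => ?_) (fun i => hermiteH_mulVec_hermiteVec (hroot i)) hκ i).comp ht
  · refine this.congr fun β => ?_
    simp only [Function.comp_apply, inv_inv, div_eq_inv_mul]
  · rw [hermiteVec_dotProduct_self]
    exact (sum_Hpoly_sq_pos hk _).ne'

theorem hermite_eig_fluctuations (k : ℕ) (hk : 1 ≤ k)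
    (h : Fin k → ℝ) (hanti : StrictAnti h) (hroot : ∀ i, Hpoly k (h i) = 0) :
    ∃ ν : Measure (Fin k → ℝ), IsCenteredGaussianVec ν (hermCov k h) ∧
      ∀ f : BoundedContinuousFunction (Fin k → ℝ) ℝ,
        Tendsto (fun β : ℝ => ∫ x, f x ∂(Measure.map
            (fun A => fun i => Real.sqrt β *
              (ithLargestEig A i - h i / Real.sqrt (2 * (k:ℝ))))
            (hermiteLaw k β)))
          atTop
          (𝓝 (∫ x, f x ∂(Measure.map (fun x => (Real.sqrt (2 * (k:ℝ)))⁻¹ • x) ν))) := by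
  refine ⟨_, isCenteredGaussianVec_map_hermiteLimit h, fun f => ?_⟩
  have hlimm := measurable_hermiteLimit h
  rw [Measure.map_map (by fun_prop) hlimm,
    integral_map (by fun_prop) f.continuous.aestronglyMeasurable]
  simp only [gaussianReal_eq_withDensity_ofReal, Function.comp_apply]
  have hs : ∀ j : Fin (k - 1),
      Tendsto (fun β : ℝ => √β * (√((k : ℝ) - 1 - (j : ℕ)) / √2)) atTop atTop := by
    intro j
    have hj : (j : ℕ) + 1 < k := by have := j.isLt; omega
    have hj' : ((j : ℕ) : ℝ) + 1 < k := by exact_mod_cast hj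
    have hpos : 0 < (k : ℝ) - 1 - (j : ℕ) := by linarith
    exact Real.tendsto_sqrt_atTop.atTop_mul_const (by positivity)
  have hF : ∀ β : ℝ, Measurable fun p : (Fin k → ℝ) × (Fin (k - 1) → ℝ) =>
      f (fun i => √β * (ithLargestEig
        ((√(2 * (k : ℝ)))⁻¹ • (hermiteH k + (√β)⁻¹ • symTridiagOf p.1 p.2)) i -
          h i / √(2 * (k : ℝ)))) := by
    intro β
    have heq : ∀ p : (Fin k → ℝ) × (Fin (k - 1) → ℝ),
        (√(2 * (k : ℝ)))⁻¹ • (hermiteH k + (√β)⁻¹ • symTridiagOf p.1 p.2) =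
          symTridiagOf ((√(2 * (k : ℝ)))⁻¹ • ((fun _ => 0) + (√β)⁻¹ • p.1))
            ((√(2 * (k : ℝ)))⁻¹ •
              ((fun j : Fin (k - 1) => √((k : ℝ) - 1 - (j : ℕ)) / √2) + (√β)⁻¹ • p.2)) := by
      intro p
      rw [symTridiagOf_smul, symTridiagOf_add, symTridiagOf_smul, hermiteH]
    simp only [heq]
    refine f.continuous.measurable.comp (measurable_pi_iff.2 fun i =>
      ((measurable_pi_iff.1 (measurable_ithLargestEig
        (measurable_symTridiagOf (by fun_prop) (by fun_prop))
        fun p => symTridiagOf_isHermitian _ _) i).sub_const _).const_mul _)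
  refine (tendsto_integral_prod_pi_withDensity
    (ρ := fun β (j : Fin (k - 1)) => chiShiftPDF (√β * (√((k : ℝ) - 1 - (j : ℕ)) / √2)))
    (ρ₀ := fun _ => gaussianPDFReal 0 (1 / 4)) _ (fun _ _ => measurable_chiShiftPDF _)
    (fun _ => measurable_gaussianPDFReal _ _) (fun _ _ => chiShiftPDF_nonneg _)
    (fun _ => gaussianPDFReal_nonneg _ _) (fun _ => integrable_gaussianPDFReal _ _)
    integrable_exp_abs_sub_sq (fun j => (hs j).eventually eventually_chiShiftPDF_le)
    (fun j z => (tendsto_chiShiftPDF z).comp (hs j)) hF (fun β p => f.norm_coe_le_norm _)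
    (fun p => (f.continuous.tendsto _).comp
      (tendsto_scaled_ithLargestEig hk hanti hroot p))).congr' ?_
  filter_upwards [eventually_gt_atTop 0] with β hβ
  exact (integral_hermiteLaw hβ _ f).symm

end
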